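/- Fix 0 ≤ H < 1 and a ≠ 0, and define ρ, λ and the profile curve c(s) = e^{λ(s)}·(tanh ρ(s), sech ρ(s)) as in the 0 ≤ H < 1 natural parametrization. Then ρ is an even function, λ is an odd function, ‖c(s)‖ = e^{λ(s)}, and c(−s) = c(s)/‖c(s)‖² for all s; that is, the profile curve is symmetric under the Euclidean inversion through the unit circle (the geodesic radius). -/

import Mathlib

/-- The primitive based at `0` of an even function is odd. -/
theorem intervalIntegral_zero_neg_of_even {f : ℝ → ℝ} (hf : ∀ t, f (-t) = f t) (s : ℝ) :
    ∫ t in (0:ℝ)..(-s), f t = -∫ t in (0:ℝ)..s, f t := by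
  have h := intervalIntegral.integral_comp_neg (a := 0) (b := s) f
  simp only [hf, neg_zero] at h
  rw [h, intervalIntegral.integral_symm]

theorem tanh_sq_add_one_div_cosh_sq (x : ℝ) :
    Real.tanh x ^ 2 + (1 / Real.cosh x) ^ 2 = 1 := by
  have hx := (Real.cosh_pos x).ne'
  rw [Real.tanh_eq_sinh_div_cosh]
  field_simp
  exact (Real.cosh_sq x).symm

/-- Symmetry of the `0 ≤ H < 1` profile curve with respect to the geodesic radius: `ρ` is even,
`λ` is odd, `‖c(s)‖ = e^{λ(s)}` for `c(s) = e^{λ(s)}(tanh ρ(s), sech ρ(s))`, and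
`c(−s) = c(s)/‖c(s)‖²`, i.e. the profile curve is symmetric under the Euclidean inversion
through the unit circle. -/
theorem profile_curve_symmetry_H_lt_one (H a A B α : ℝ)
    (hH₀ : 0 ≤ H) (hH₁ : H < 1) (ha : a ≠ 0)
    (hA : A = 1 + 2*a*H) (hB : B = Real.sqrt (1 + 4*a*H + 4*a ^ 2))
    (hα : α = Real.sqrt (1 - H ^ 2))
    (U ρ lam : ℝ → ℝ) (c : ℝ → ℝ × ℝ)
    (hU : ∀ s, U s = Real.sqrt ((-A + B * Real.cosh (2*α*s)) / (2 * α ^ 2)))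
    (hρ : ∀ s, ρ s = Real.arsinh (U s))
    (hlam : ∀ s, lam s = ∫ t in (0:ℝ)..s,
      (Real.sqrt 2 * α * (-(2*a) + H * (-1 + B * Real.cosh (2*α*t)))
          * Real.sqrt (-A + B * Real.cosh (2*α*t)))
        / ((-(2*a) + H * (-1 + B * Real.cosh (2*α*t))) ^ 2
            + α ^ 2 * B ^ 2 * Real.sinh (2*α*t) ^ 2))
    (hc : ∀ s, c s = (Real.exp (lam s) * Real.tanh (ρ s),
                      Real.exp (lam s) * (1 / Real.cosh (ρ s)))) :
    (∀ s, ρ (-s) = ρ s) ∧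
    (∀ s, lam (-s) = - lam s) ∧
    (∀ s, Real.sqrt ((c s).1 ^ 2 + (c s).2 ^ 2) = Real.exp (lam s)) ∧
    (∀ s, c (-s) = ((c s).1 / ((c s).1 ^ 2 + (c s).2 ^ 2),
                    (c s).2 / ((c s).1 ^ 2 + (c s).2 ^ 2))) := by
  have hρ_even : ∀ s, ρ (-s) = ρ s := fun s => by
    simp only [hρ, hU, mul_neg, Real.cosh_neg]
  have hlam_odd : ∀ s, lam (-s) = -lam s := fun s => by
    rw [hlam, hlam]
    exact intervalIntegral_zero_neg_of_even
      (fun t => by simp only [mul_neg, Real.cosh_neg, Real.sinh_neg, neg_sq]) s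
  have hnorm_sq : ∀ s, (c s).1 ^ 2 + (c s).2 ^ 2 = Real.exp (lam s) ^ 2 := fun s => by
    rw [hc]
    dsimp only
    rw [mul_pow, mul_pow, ← mul_add, tanh_sq_add_one_div_cosh_sq, mul_one]
  refine ⟨hρ_even, hlam_odd, fun s => ?_, fun s => ?_⟩
  · rw [hnorm_sq, Real.sqrt_sq (Real.exp_pos _).le]
  · have he := (Real.exp_pos (lam s)).ne'
    rw [hnorm_sq, hc (-s), hc s, hρ_even, hlam_odd, Real.exp_neg]
    ext <;> dsimp only <;> field_simp
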